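/- Let Ω be an open convex proper subset of ℝⁿ with finite inner radius δ₀ = sup_{x∈Ω} dist(x, ∂Ω). Let p ≥ 1, m > 1, ν ∈ [0, 1/m], λ ∈ [0, (1 + νm)/2), and let c > 0 satisfy (1 − 2λ)·J_ν(2c/m) + 2c·J′_ν(2c/m) = 0 with 2c/m ∈ (0, j_ν). Then for every g ∈ C₀¹(Ω): (1 − p·ν²m²)·∫_Ω |g(x)|^p/δ(x)² dx + (4p·(c² + (m − 1)(λ − λ²))/δ₀^m)·∫_Ω |g(x)|^p/δ(x)^{2−m} dx ≤ p^p·(2(1 + νm) − 4λ²)^p·∫_Ω |∇g(x)|^p/δ(x)^{2−p} dx. -/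

import Mathlib

open MeasureTheory Real Set Filter

/-- Bessel function of the first kind of real order `ν`, defined for `x > 0` by its series. -/
noncomputable def besselJ (ν x : ℝ) : ℝ :=
  ∑' k : ℕ, (-1 : ℝ) ^ k * x ^ (2 * (k : ℝ) + ν) /
    (2 ^ (2 * (k : ℝ) + ν) * (Nat.factorial k : ℝ) * Real.Gamma ((k : ℝ) + 1 + ν))

/-- The sum of a power series whose coefficients are dominated by `M / k!` may be differentiated
term by term. -/
theorem hasDerivAt_tsum_mul_pow {a : ℕ → ℝ} {M : ℝ}
    (ha : ∀ k, |a k| ≤ M / (k.factorial : ℝ)) (w : ℝ) :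
    HasDerivAt (fun z => ∑' k, a k * z ^ k) (∑' k : ℕ, ((k : ℝ) + 1) * a (k + 1) * w ^ k) w := by
  have hM : 0 ≤ M := by simpa using (abs_nonneg _).trans (ha 0)
  set R : ℝ := |w| + 1 with hR
  have hR0 : 0 < R := by positivity
  have hsum : Summable fun k : ℕ => M * (R ^ (k - 1) / ((k - 1).factorial : ℝ)) := by
    apply Summable.mul_left
    refine (summable_nat_add_iff 1).1 ?_
    simpa using Real.summable_pow_div_factorial R
  have hder : ∀ (k : ℕ) (y : ℝ), y ∈ Metric.ball (0 : ℝ) R →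
      HasDerivAt (fun z => a k * z ^ k) (a k * (k * y ^ (k - 1))) y :=
    fun k y _ => (hasDerivAt_pow k y).const_mul (a k)
  have hbound : ∀ (k : ℕ) (y : ℝ), y ∈ Metric.ball (0 : ℝ) R →
      ‖a k * (k * y ^ (k - 1))‖ ≤ M * (R ^ (k - 1) / ((k - 1).factorial : ℝ)) := by
    intro k y hy
    rw [mem_ball_zero_iff, Real.norm_eq_abs] at hy
    rcases k with _ | k
    · simpa using hM
    · rw [norm_mul, norm_mul, norm_pow, Real.norm_eq_abs, Real.norm_eq_abs, Real.norm_eq_abs,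
        Nat.abs_cast, Nat.add_sub_cancel]
      calc |a (k + 1)| * (((k + 1 : ℕ) : ℝ) * |y| ^ k)
          ≤ M / ((k + 1).factorial : ℝ) * (((k + 1 : ℕ) : ℝ) * R ^ k) := by
            gcongr
            exact ha _
        _ = M * (R ^ k / (k.factorial : ℝ)) := by
            rw [Nat.factorial_succ]
            push_cast
            field_simp
  have hzero : Summable fun k => a k * (0 : ℝ) ^ k :=
    summable_of_ne_finset_zero (s := {0}) fun k hk => by
      simp only [Finset.mem_singleton] at hk
      simp [hk]
  have hw : w ∈ Metric.ball (0 : ℝ) R := by simp [hR]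
  have key := hasDerivAt_tsum_of_isPreconnected hsum Metric.isOpen_ball
    (convex_ball (0 : ℝ) R).isPreconnected hder hbound (Metric.mem_ball_self hR0) hzero hw
  refine key.congr_deriv ?_
  have hs : Summable fun k : ℕ => a k * (k * w ^ (k - 1)) :=
    .of_norm_bounded hsum fun k => hbound k w hw
  rw [hs.tsum_eq_zero_add]
  simp only [Nat.cast_zero, zero_mul, mul_zero, zero_add]
  refine tsum_congr fun k => ?_
  rw [Nat.add_sub_cancel]
  push_cast
  ring

theorem summable_mul_pow_of_abs_le {a : ℕ → ℝ} {M : ℝ}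
    (ha : ∀ k, |a k| ≤ M / (k.factorial : ℝ)) (w : ℝ) : Summable fun k => a k * w ^ k := by
  refine .of_norm_bounded ((Real.summable_pow_div_factorial |w|).mul_left M) fun k => ?_
  rw [norm_mul, norm_pow, Real.norm_eq_abs, Real.norm_eq_abs]
  calc |a k| * |w| ^ k ≤ M / (k.factorial : ℝ) * |w| ^ k := by gcongr; exact ha k
    _ = M * (|w| ^ k / (k.factorial : ℝ)) := by ring

/-- Coefficients of the entire function `E` with `J_ν(x) = (x / 2) ^ ν * E (x² / 4)`. -/
noncomputable def besselCoeff (ν : ℝ) (k : ℕ) : ℝ :=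
  (-1) ^ k / ((k.factorial : ℝ) * Real.Gamma ((k : ℝ) + 1 + ν))

/-- The entire function `E` with `J_ν(x) = (x / 2) ^ ν * E (x² / 4)`. -/
noncomputable def besselEntire (ν w : ℝ) : ℝ := ∑' k, besselCoeff ν k * w ^ k

/-- The derivative of `besselEntire ν`. -/
noncomputable def besselEntireDeriv (ν w : ℝ) : ℝ :=
  ∑' k : ℕ, ((k : ℝ) + 1) * besselCoeff ν (k + 1) * w ^ k

theorem Gamma_one_add_le {ν : ℝ} (hν : 0 ≤ ν) (k : ℕ) :
    Real.Gamma (1 + ν) * k.factorial ≤ Real.Gamma ((k : ℝ) + 1 + ν) := by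
  induction k with
  | zero => simp
  | succ k ih =>
    have h : ((k + 1 : ℕ) : ℝ) + 1 + ν = ((k : ℝ) + 1 + ν) + 1 := by push_cast; ring
    have hpos : 0 < (k : ℝ) + 1 + ν := by positivity
    rw [h, Real.Gamma_add_one hpos.ne', Nat.factorial_succ]
    push_cast
    have hG : 0 < Real.Gamma (1 + ν) := Real.Gamma_pos_of_pos (by positivity)
    calc Real.Gamma (1 + ν) * (((k : ℝ) + 1) * k.factorial)
        = ((k : ℝ) + 1) * (Real.Gamma (1 + ν) * k.factorial) := by ring
      _ ≤ ((k : ℝ) + 1 + ν) * Real.Gamma ((k : ℝ) + 1 + ν) :=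
        mul_le_mul (le_add_of_nonneg_right hν) ih (by positivity) hpos.le

theorem besselCoeff_succ {ν : ℝ} (hν : 0 ≤ ν) (k : ℕ) :
    ((k : ℝ) + 1) * ((k : ℝ) + 1 + ν) * besselCoeff ν (k + 1) = -besselCoeff ν k := by
  have h : ((k + 1 : ℕ) : ℝ) + 1 + ν = ((k : ℝ) + 1 + ν) + 1 := by push_cast; ring
  have hpos : 0 < (k : ℝ) + 1 + ν := by positivity
  have hG : 0 < Real.Gamma ((k : ℝ) + 1 + ν) := Real.Gamma_pos_of_pos hpos
  unfold besselCoeff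
  rw [h, Real.Gamma_add_one hpos.ne', Nat.factorial_succ]
  push_cast
  field_simp
  ring

theorem abs_besselCoeff_mul_le {ν : ℝ} (hν : 0 ≤ ν) (k : ℕ) :
    ((k : ℝ) + 1) * |besselCoeff ν k| ≤ (2 / Real.Gamma (1 + ν)) / (k.factorial : ℝ) := by
  have hG : 0 < Real.Gamma (1 + ν) := Real.Gamma_pos_of_pos (by positivity)
  have hGk : 0 < Real.Gamma ((k : ℝ) + 1 + ν) := Real.Gamma_pos_of_pos (by positivity)
  have hk : ((k : ℝ) + 1) ≤ 2 * k.factorial := by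
    have h1 : k ≤ k.factorial := Nat.self_le_factorial k
    have h2 : 1 ≤ k.factorial := Nat.factorial_pos k
    have : k + 1 ≤ 2 * k.factorial := by lia
    exact_mod_cast this
  have hle := Gamma_one_add_le hν k
  have hf : (0 : ℝ) < k.factorial := by positivity
  unfold besselCoeff
  rw [abs_div, abs_pow, abs_neg, abs_one, one_pow, abs_of_pos (by positivity), div_div,
    mul_one_div, div_le_div_iff₀ (by positivity) (by positivity)]
  calc ((k : ℝ) + 1) * (Real.Gamma (1 + ν) * k.factorial)
      ≤ (2 * k.factorial) * Real.Gamma ((k : ℝ) + 1 + ν) := by gcongr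
    _ = 2 * (k.factorial * Real.Gamma ((k : ℝ) + 1 + ν)) := by ring

theorem abs_besselCoeff_le {ν : ℝ} (hν : 0 ≤ ν) (k : ℕ) :
    |besselCoeff ν k| ≤ (2 / Real.Gamma (1 + ν)) / (k.factorial : ℝ) := by
  refine le_trans ?_ (abs_besselCoeff_mul_le hν k)
  nlinarith [abs_nonneg (besselCoeff ν k), (Nat.cast_nonneg k : (0 : ℝ) ≤ k)]

theorem hasDerivAt_besselEntire {ν : ℝ} (hν : 0 ≤ ν) (w : ℝ) :
    HasDerivAt (besselEntire ν) (besselEntireDeriv ν w) w :=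
  hasDerivAt_tsum_mul_pow (abs_besselCoeff_le hν) w

/-- The Bessel equation in first-order form: `(w E' + ν E)' = -E`. -/
theorem hasDerivAt_mul_besselEntireDeriv_add {ν : ℝ} (hν : 0 ≤ ν) (w : ℝ) :
    HasDerivAt (fun z => z * besselEntireDeriv ν z + ν * besselEntire ν z)
      (-besselEntire ν w) w := by
  have hk : ∀ k : ℕ, |(k : ℝ) * besselCoeff ν k| ≤
      (2 / Real.Gamma (1 + ν)) / (k.factorial : ℝ) := fun k => by
    refine le_trans ?_ (abs_besselCoeff_mul_le hν k)
    rw [abs_mul, Nat.abs_cast]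
    gcongr
    linarith
  have hsum : ∀ k : ℕ, |((k : ℝ) + ν) * besselCoeff ν k| ≤
      ((1 + ν) * (2 / Real.Gamma (1 + ν))) / (k.factorial : ℝ) := fun k => by
    rw [abs_mul, abs_of_nonneg (by positivity), mul_div_assoc]
    calc ((k : ℝ) + ν) * |besselCoeff ν k|
        ≤ (1 + ν) * (((k : ℝ) + 1) * |besselCoeff ν k|) := by
          rw [← mul_assoc]
          gcongr
          nlinarith [(Nat.cast_nonneg k : (0 : ℝ) ≤ k)]
      _ ≤ _ := by gcongr; exact abs_besselCoeff_mul_le hν k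
  have key := hasDerivAt_tsum_mul_pow hsum w
  have hfun : (fun z => ∑' k : ℕ, ((k : ℝ) + ν) * besselCoeff ν k * z ^ k) =
      fun z => z * besselEntireDeriv ν z + ν * besselEntire ν z := by
    ext z
    have h1 := summable_mul_pow_of_abs_le hk z
    have h2 := summable_mul_pow_of_abs_le (abs_besselCoeff_le hν) z
    have h3 : ∑' k : ℕ, (k : ℝ) * besselCoeff ν k * z ^ k = z * besselEntireDeriv ν z := by
      rw [h1.tsum_eq_zero_add, besselEntireDeriv, ← tsum_mul_left]
      simp only [Nat.cast_zero, zero_mul, zero_add]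
      congr 1
      ext k
      push_cast
      ring
    rw [besselEntire, ← h3, ← tsum_mul_left, ← h1.tsum_add (h2.mul_left ν)]
    congr 1
    ext k
    ring
  have hval : ∑' k : ℕ, ((k : ℝ) + 1) * ((((k + 1 : ℕ) : ℝ) + ν) * besselCoeff ν (k + 1)) * w ^ k =
      -besselEntire ν w := by
    rw [besselEntire, ← tsum_neg]
    congr 1
    ext k
    have h := besselCoeff_succ hν k
    push_cast
    linear_combination w ^ k * h
  rw [hfun, hval] at key
  exact key

theorem besselJ_eq {ν x : ℝ} (hx : 0 < x) :
    besselJ ν x = (x / 2) ^ ν * besselEntire ν (x ^ 2 / 4) := by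
  unfold besselJ besselEntire besselCoeff
  rw [← tsum_mul_left]
  congr 1
  ext k
  have h2 : ∀ y : ℝ, 0 < y → y ^ (2 * (k : ℝ) + ν) = (y ^ 2) ^ k * y ^ ν := fun y hy => by
    rw [Real.rpow_add hy, ← pow_mul, ← Real.rpow_natCast y (2 * k)]
    push_cast
    rfl
  rw [h2 x hx, h2 2 two_pos, Real.div_rpow hx.le two_pos.le, div_pow]
  have : (0 : ℝ) < 2 ^ ν := by positivity
  norm_num
  field_simp

theorem hasDerivAt_besselJ {ν x : ℝ} (hν : 0 ≤ ν) (hx : 0 < x) :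
    HasDerivAt (besselJ ν) ((x / 2) ^ ν *
      (ν / x * besselEntire ν (x ^ 2 / 4) + x / 2 * besselEntireDeriv ν (x ^ 2 / 4))) x := by
  have h1 : HasDerivAt (fun y : ℝ => (y / 2) ^ ν) (1 / 2 * ν * (x / 2) ^ (ν - 1)) x :=
    ((hasDerivAt_id x).div_const 2).rpow_const (Or.inl (by simp [hx.ne']))
  have h2 : HasDerivAt (fun y : ℝ => y ^ 2 / 4) (2 * x / 4) x := by
    simpa using (hasDerivAt_pow 2 x).div_const 4
  have h3 := (hasDerivAt_besselEntire hν (x ^ 2 / 4)).comp x h2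
  have h4 : HasDerivAt (besselJ ν) _ x := (h1.mul h3).congr_of_eventuallyEq <| by
    filter_upwards [lt_mem_nhds hx] with y hy using besselJ_eq hy
  refine h4.congr_deriv ?_
  rw [Real.rpow_sub_one (by positivity)]
  simp only [Function.comp]
  field_simp
  ring

/-- If `w f' + ν f ≥ 0` on `(0, b)` and `f 0 = 0`, then `f ≥ 0` on `[0, b]`: the function
`w ^ ν f` is monotone. -/
theorem nonneg_of_mul_deriv_add_mul_nonneg {ν b : ℝ} {f f' : ℝ → ℝ} (hν : 0 ≤ ν)
    (hf : ∀ w, HasDerivAt f (f' w) w) (h0 : f 0 = 0)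
    (hpos : ∀ w ∈ Ioo 0 b, 0 ≤ w * f' w + ν * f w) {w : ℝ} (hw : w ∈ Icc 0 b) : 0 ≤ f w := by
  have hmono : MonotoneOn (fun z => z ^ ν * f z) (Icc 0 b) := by
    refine monotoneOn_of_hasDerivWithinAt_nonneg
      (f' := fun z => ν * z ^ (ν - 1) * f z + z ^ ν * f' z) (convex_Icc 0 b) ?_ ?_ ?_
    · refine ContinuousOn.mul ?_ fun z _ => (hf z).continuousAt.continuousWithinAt
      exact (Real.continuous_rpow_const hν).continuousOn
    · intro z hz
      rw [interior_Icc] at hz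
      exact ((Real.hasDerivAt_rpow_const (Or.inl hz.1.ne')).mul (hf z)).hasDerivWithinAt
    · intro z hz
      rw [interior_Icc] at hz
      have hz0 : 0 < z := hz.1
      have : ν * z ^ (ν - 1) * f z + z ^ ν * f' z = z ^ (ν - 1) * (z * f' z + ν * f z) := by
        rw [Real.rpow_sub_one hz0.ne']
        field_simp
        ring
      rw [this]
      exact mul_nonneg (by positivity) (hpos z hz)
  rcases hw.1.eq_or_lt with rfl | hw0
  · exact h0.ge
  · have h := hmono (left_mem_Icc.2 (hw.1.trans hw.2)) hw hw.1
    simp only [h0, mul_zero] at h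
    exact nonneg_of_mul_nonneg_right h (by positivity)

theorem hasDerivAt_mul_besselEntireDeriv {ν : ℝ} (hν : 0 ≤ ν) (w : ℝ) :
    HasDerivAt (fun z => z * besselEntireDeriv ν z)
      (-besselEntire ν w - ν * besselEntireDeriv ν w) w := by
  have h := (hasDerivAt_mul_besselEntireDeriv_add hν w).sub
    ((hasDerivAt_besselEntire hν w).const_mul ν)
  refine h.congr_of_eventuallyEq (Eventually.of_forall fun z => ?_)
  simp

theorem mul_besselEntireDeriv_nonpos {ν b w : ℝ} (hν : 0 ≤ ν)
    (hE : ∀ z ∈ Ioo 0 b, 0 < besselEntire ν z) (hw : w ∈ Icc 0 b) :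
    w * besselEntireDeriv ν w ≤ 0 := by
  have h := nonneg_of_mul_deriv_add_mul_nonneg (b := b) hν
    (fun z => (hasDerivAt_mul_besselEntireDeriv hν z).neg) (by simp) (fun z hz => ?_) hw
  · simpa using h
  · have := mul_pos hz.1 (hE z hz)
    simp only [Pi.neg_apply]
    nlinarith

/-- Nonnegativity of the numerator of `-w (w E' / E)'`. -/
theorem besselEntire_turan_nonneg {ν w : ℝ} (hν : 0 ≤ ν) (hw : 0 ≤ w) :
    0 ≤ w * besselEntire ν w ^ 2 + ν * (w * besselEntireDeriv ν w) * besselEntire ν w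
      + (w * besselEntireDeriv ν w) ^ 2 := by
  have hder := fun z : ℝ => (((hasDerivAt_id z).mul ((hasDerivAt_besselEntire hν z).pow 2)).add
    (((hasDerivAt_mul_besselEntireDeriv hν z).const_mul ν).mul (hasDerivAt_besselEntire hν z))).add
    ((hasDerivAt_mul_besselEntireDeriv hν z).pow 2)
  have h := nonneg_of_mul_deriv_add_mul_nonneg (b := w) hν hder (by simp)
    (fun z hz => ?_) (right_mem_Icc.2 hw)
  · simpa using h
  · have : 0 ≤ z * besselEntire ν z ^ 2 := mul_nonneg hz.1.le (sq_nonneg _)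
    convert this using 1
    simp
    ring

theorem hasDerivAt_besselEntire_logDeriv {ν w : ℝ} (hν : 0 ≤ ν) (hw : w ≠ 0)
    (hE : besselEntire ν w ≠ 0) :
    HasDerivAt (fun z => z * besselEntireDeriv ν z / besselEntire ν z)
      (-(w + ν * (w * besselEntireDeriv ν w / besselEntire ν w)
        + (w * besselEntireDeriv ν w / besselEntire ν w) ^ 2) / w) w := by
  refine ((hasDerivAt_mul_besselEntireDeriv hν w).div (hasDerivAt_besselEntire hν w) hE).congr_deriv
    ?_
  field_simp
  ring

theorem antitoneOn_besselEntire_logDeriv {ν b : ℝ} (hν : 0 ≤ ν)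
    (hE : ∀ z ∈ Ioc 0 b, 0 < besselEntire ν z) :
    AntitoneOn (fun z => z * besselEntireDeriv ν z / besselEntire ν z) (Ioc 0 b) := by
  refine antitoneOn_of_hasDerivWithinAt_nonpos (convex_Ioc 0 b)
    (fun z hz => (hasDerivAt_besselEntire_logDeriv hν hz.1.ne' (hE z hz).ne').continuousAt
      |>.continuousWithinAt)
    (fun z hz => (hasDerivAt_besselEntire_logDeriv hν (interior_subset hz).1.ne'
      (hE z (interior_subset hz)).ne').hasDerivWithinAt) fun z hz => ?_
  have hz' := interior_subset hz
  have hEz := hE z hz'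
  have hM := besselEntire_turan_nonneg hν hz'.1.le
  refine div_nonpos_of_nonpos_of_nonneg (neg_nonpos.2 ?_) hz'.1.le
  have : z + ν * (z * besselEntireDeriv ν z / besselEntire ν z)
        + (z * besselEntireDeriv ν z / besselEntire ν z) ^ 2 =
      (z * besselEntire ν z ^ 2 + ν * (z * besselEntireDeriv ν z) * besselEntire ν z
      + (z * besselEntireDeriv ν z) ^ 2) / besselEntire ν z ^ 2 := by
    field_simp
  rw [this]
  positivity

/-- Comparison with a solution `y / t` of the Riccati equation
`-u' = u² + (1 - κ²) / (4 t²) + c² t ^ (m - 2)`. -/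
theorem hardy_weight_le_of_riccati {m κ lam c : ℝ} {y : ℝ → ℝ} (hm : 1 < m)
    (hlam0 : 0 ≤ lam) (hlam1 : lam ≤ 1)
    (hy1 : y 1 = lam) (hylow : ∀ t ∈ Ioc (0 : ℝ) 1, lam ≤ y t)
    (hyup : ∀ t ∈ Ioc (0 : ℝ) 1, y t ≤ (1 + κ) / 2)
    (hy : ∀ t ∈ Ioc (0 : ℝ) 1,
      HasDerivAt y ((y t - y t ^ 2 - (1 - κ ^ 2) / 4 - c ^ 2 * t ^ m) / t) t)
    {t : ℝ} (ht : t ∈ Ioc (0 : ℝ) 1) :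
    (1 - κ ^ 2) * (1 - t) + 4 * (c ^ 2 + (m - 1) * (lam - lam ^ 2)) / (m - 1) * (t - t ^ m)
      ≤ 2 * (1 + κ) - 4 * lam ^ 2 := by
  have hm' : 0 < m - 1 := by linarith
  set ψ : ℝ → ℝ := fun s => 4 * (y s / s) - 4 * lam ^ 2 * s⁻¹ - (1 - κ ^ 2) * s⁻¹
    + 4 * c ^ 2 / (m - 1) * s ^ (m - 1) with hψ
  have hder : ∀ s ∈ Ioc (0 : ℝ) 1, HasDerivAt ψ (-4 * (y s ^ 2 - lam ^ 2) / s ^ 2) s := by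
    intro s hs
    have hs0 : s ≠ 0 := hs.1.ne'
    have h1 := ((hy s hs).div (hasDerivAt_id s) hs0).const_mul 4
    have h2 := (hasDerivAt_inv hs0).const_mul (4 * lam ^ 2)
    have h3 := (hasDerivAt_inv hs0).const_mul (1 - κ ^ 2)
    have h4 := (Real.hasDerivAt_rpow_const (p := m - 1) (Or.inl hs0)).const_mul
      (4 * c ^ 2 / (m - 1))
    refine (((h1.sub h2).sub h3).add h4).congr_deriv ?_
    rw [Real.rpow_sub_one hs0, Real.rpow_sub_one hs0]
    simp only [id]
    field_simp
    ring
  have hanti : AntitoneOn ψ (Ioc 0 1) :=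
    antitoneOn_of_hasDerivWithinAt_nonpos (convex_Ioc 0 1)
      (fun s hs => (hder s hs).continuousAt.continuousWithinAt)
      (fun s hs => (hder s (interior_subset hs)).hasDerivWithinAt) fun s hs => by
        have hl := hylow s (interior_subset hs)
        have : 0 ≤ y s ^ 2 - lam ^ 2 := by nlinarith
        exact div_nonpos_of_nonpos_of_nonneg (by linarith) (sq_nonneg s)
  have h := hanti ht ⟨one_pos, le_rfl⟩ ht.2
  simp only [hψ, hy1, div_one, inv_one, Real.one_rpow, mul_one] at h
  have ht0 : 0 < t := ht.1
  have hmul := mul_le_mul_of_nonneg_left h ht0.le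
  rw [Real.rpow_sub_one ht0.ne'] at hmul
  have e : t * (4 * (y t / t) - 4 * lam ^ 2 * t⁻¹ - (1 - κ ^ 2) * t⁻¹
      + 4 * c ^ 2 / (m - 1) * (t ^ m / t)) =
      4 * y t - 4 * lam ^ 2 - (1 - κ ^ 2) + 4 * c ^ 2 / (m - 1) * t ^ m := by
    field_simp
  rw [e] at hmul
  have hup := hyup t ht
  have htm : 0 ≤ t ^ m := by positivity
  have hl : 0 ≤ (lam - lam ^ 2) * t ^ m := mul_nonneg (by nlinarith) htm
  have e2 : 4 * (c ^ 2 + (m - 1) * (lam - lam ^ 2)) / (m - 1) * (t - t ^ m) =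
      4 * c ^ 2 / (m - 1) * t - 4 * c ^ 2 / (m - 1) * t ^ m +
      4 * (lam - lam ^ 2) * (t - t ^ m) := by
    field_simp
  rw [e2]
  nlinarith

theorem hardy_weight_le {m ν lam c jν : ℝ} (hm : 1 < m) (hν : ν ∈ Icc 0 (1 / m))
    (hlam : lam ∈ Ico 0 ((1 + ν * m) / 2)) (hc : 0 < c)
    (hjν_first : ∀ t ∈ Ioo 0 jν, 0 < besselJ ν t) (hcm : 2 * c / m ∈ Ioo 0 jν)
    (hroot : (1 - 2 * lam) * besselJ ν (2 * c / m)
      + 2 * c * deriv (besselJ ν) (2 * c / m) = 0) {t : ℝ} (ht : t ∈ Ioc (0 : ℝ) 1) :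
    (1 - (ν * m) ^ 2) * (1 - t)
      + 4 * (c ^ 2 + (m - 1) * (lam - lam ^ 2)) / (m - 1) * (t - t ^ m)
      ≤ 2 * (1 + ν * m) - 4 * lam ^ 2 := by
  have hm0 : 0 < m := by linarith
  have hν0 := hν.1
  have hνm : ν * m ≤ 1 := (le_div_iff₀ hm0).1 hν.2
  set w₁ : ℝ := (c / m) ^ 2 with hw₁
  have hw₁pos : 0 < w₁ := by positivity
  have hE : ∀ z ∈ Ioc 0 w₁, 0 < besselEntire ν z := by
    intro z hz
    have hz0 := hz.1
    have hsq : √z ≤ c / m := Real.sqrt_le_iff.2 ⟨by positivity, hz.2⟩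
    have hpos : 0 < 2 * √z := by positivity
    have hJ := hjν_first (2 * √z) ⟨hpos, lt_of_le_of_lt (by rw [mul_div_assoc]; gcongr) hcm.2⟩
    rw [besselJ_eq hpos] at hJ
    have e : (2 * √z) ^ 2 / 4 = z := by rw [mul_pow, Real.sq_sqrt hz0.le]; ring
    rw [e] at hJ
    exact pos_of_mul_pos_right hJ (by positivity)
  have hEw₁ := hE w₁ ⟨hw₁pos, le_rfl⟩
  have hlamEq : lam = (1 + ν * m) / 2 + m * (w₁ * besselEntireDeriv ν w₁ / besselEntire ν w₁) := by
    rw [(hasDerivAt_besselJ hν0 hcm.1).deriv, besselJ_eq hcm.1] at hroot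
    have e : (2 * c / m) ^ 2 / 4 = w₁ := by rw [hw₁]; ring
    have hp : (0 : ℝ) < (2 * c / m / 2) ^ ν := by positivity
    rw [e] at hroot
    have h0 : (1 - 2 * lam) * besselEntire ν w₁ + 2 * c * (ν / (2 * c / m) * besselEntire ν w₁ +
        2 * c / m / 2 * besselEntireDeriv ν w₁) = 0 := by
      refine (mul_eq_zero.1 ?_).resolve_left hp.ne'
      linear_combination hroot
    have e2 : 2 * c * (ν / (2 * c / m) * besselEntire ν w₁ +
        2 * c / m / 2 * besselEntireDeriv ν w₁) =
        ν * m * besselEntire ν w₁ + 2 * m * (w₁ * besselEntireDeriv ν w₁) := by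
      rw [hw₁]
      field_simp
    rw [e2] at h0
    field_simp
    linarith
  set y : ℝ → ℝ := fun s => (1 + ν * m) / 2 + m * (w₁ * s ^ m * besselEntireDeriv ν (w₁ * s ^ m) /
    besselEntire ν (w₁ * s ^ m)) with hy
  have hmem : ∀ s ∈ Ioc (0 : ℝ) 1, w₁ * s ^ m ∈ Ioc 0 w₁ := fun s hs =>
    ⟨mul_pos hw₁pos (Real.rpow_pos_of_pos hs.1 m),
      mul_le_of_le_one_right hw₁pos.le (Real.rpow_le_one hs.1.le hs.2 hm0.le)⟩
  refine hardy_weight_le_of_riccati (y := y) hm hlam.1 (by linarith [hlam.2]) ?_ ?_ ?_ ?_ ht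
  · simp only [hy, Real.one_rpow, mul_one]
    exact hlamEq.symm
  · intro s hs
    have h := antitoneOn_besselEntire_logDeriv hν0 hE (hmem s hs) ⟨hw₁pos, le_rfl⟩ (hmem s hs).2
    rw [hlamEq]
    simp only [hy]
    gcongr
  · intro s hs
    have h := mul_besselEntireDeriv_nonpos hν0 (fun z hz => hE z ⟨hz.1, hz.2.le⟩)
      ⟨(hmem s hs).1.le, (hmem s hs).2⟩
    have h2 := div_nonpos_of_nonpos_of_nonneg h (hE _ (hmem s hs)).le
    have h3 := mul_nonpos_of_nonneg_of_nonpos hm0.le h2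
    simp only [hy]
    linarith
  · intro s hs
    have hs0 : s ≠ 0 := hs.1.ne'
    have h1 := hasDerivAt_besselEntire_logDeriv hν0 (hmem s hs).1.ne' (hE _ (hmem s hs)).ne'
    have h2 : HasDerivAt (fun r : ℝ => w₁ * r ^ m) (w₁ * (m * s ^ (m - 1))) s :=
      (Real.hasDerivAt_rpow_const (Or.inl hs0)).const_mul w₁
    refine (((h1.comp s h2).const_mul m).const_add ((1 + ν * m) / 2)).congr_deriv ?_
    simp only [hy]
    generalize w₁ * s ^ m * besselEntireDeriv ν (w₁ * s ^ m) / besselEntire ν (w₁ * s ^ m) = r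
    have hsm : 0 < s ^ m := Real.rpow_pos_of_pos hs.1 m
    rw [Real.rpow_sub_one hs0, hw₁]
    field_simp
    ring

section Geometry

open Metric
open scoped Topology NNReal

theorem infDist_frontier_pos {E : Type*} [PseudoMetricSpace E] {Ω : Set E}
    (hΩo : IsOpen Ω) (hne : (frontier Ω).Nonempty) {x : E} (hx : x ∈ Ω) :
    0 < infDist x (frontier Ω) :=
  (isClosed_frontier.notMem_iff_infDist_pos hne).1 fun h => (hΩo.frontier_eq ▸ h).2 hx

variable {E : Type*} [NormedAddCommGroup E] [NormedSpace ℝ E]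

theorem ball_infDist_frontier_subset [FiniteDimensional ℝ E] {Ω : Set E}
    (hΩproper : Ω ≠ univ) {x : E} (hx : x ∈ Ω) : ball x (infDist x (frontier Ω)) ⊆ Ω := by
  obtain ⟨y, hy, hxy⟩ := exists_mem_frontier_infDist_compl_eq_dist hx hΩproper
  refine (ball_subset_ball ?_).trans ball_infDist_compl_subset
  rw [hxy]
  exact infDist_le_dist_of_mem hy

theorem concaveOn_infDist_frontier [FiniteDimensional ℝ E] {Ω : Set E} (hΩo : IsOpen Ω)
    (hΩconv : Convex ℝ Ω) (hne : (frontier Ω).Nonempty) (hΩproper : Ω ≠ univ) :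
    ConcaveOn ℝ Ω fun x => infDist x (frontier Ω) := by
  refine ⟨hΩconv, fun x hx y hy a b ha hb hab => ?_⟩
  have hδx := infDist_frontier_pos hΩo hne hx
  have hδy := infDist_frontier_pos hΩo hne hy
  set α := infDist x (frontier Ω) with hα
  set β := infDist y (frontier Ω) with hβ
  simp only [smul_eq_mul]
  have hr : 0 < a * α + b * β := by
    rcases ha.eq_or_lt with rfl | ha
    · have : b = 1 := by linarith
      simpa [this] using hδy
    · positivity
  refine (le_infDist hne).2 fun z hz => ?_
  by_contra! hlt
  refine (hΩo.frontier_eq ▸ hz).2 ?_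
  set r := a * α + b * β with hrdef
  set d : E := z - (a • x + b • y) with hd
  have hdr : ‖d‖ < r := by rwa [hd, ← dist_eq_norm, dist_comm]
  have hball : ∀ (u : E) (γ : ℝ), 0 < γ → u + (γ / r) • d ∈ ball u γ := fun u γ hγ => by
    rw [mem_ball, dist_eq_norm, add_sub_cancel_left, norm_smul, Real.norm_of_nonneg (by positivity),
      div_mul_eq_mul_div, div_lt_iff₀ hr]
    gcongr
  have hX := ball_infDist_frontier_subset hΩproper hx (hball x α hδx)
  have hY := ball_infDist_frontier_subset hΩproper hy (hball y β hδy)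
  have hz' : z = a • (x + (α / r) • d) + b • (y + (β / r) • d) := by
    have : a * (α / r) + b * (β / r) = 1 := by
      rw [← mul_div_assoc, ← mul_div_assoc, ← add_div, div_self hr.ne']
    calc z = a • x + b • y + (1 : ℝ) • d := by rw [one_smul, hd]; abel
      _ = _ := by rw [← this]; module
  rw [hz']
  exact hΩconv hX hY ha hb hab

/-- Where it is differentiable, the distance to a closed set has gradient of norm one. -/
theorem norm_fderiv_infDist [ProperSpace E] {s : Set E} (hs : IsClosed s) (hne : s.Nonempty) {x : E}
    (hx : 0 < infDist x s) (hd : DifferentiableAt ℝ (fun z => infDist z s) x) :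
    ‖fderiv ℝ (fun z => infDist z s) x‖ = 1 := by
  refine le_antisymm ?_ ?_
  · simpa using norm_fderiv_le_of_lipschitz (x₀ := x) ℝ (lipschitz_infDist_pt s)
  obtain ⟨y, hys, hy⟩ := hs.exists_infDist_eq_dist hne x
  have hline : ∀ t ∈ Icc (0 : ℝ) 1, infDist (x + t • (y - x)) s = (1 - t) * infDist x s := by
    intro t ht
    have hdist : dist (x + t • (y - x)) y = (1 - t) * infDist x s := by
      rw [hy, dist_eq_norm, dist_eq_norm, ← abs_of_nonneg (sub_nonneg.2 ht.2), ← Real.norm_eq_abs,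
        ← norm_smul]
      congr 1
      module
    refine le_antisymm (hdist ▸ infDist_le_dist_of_mem hys) ?_
    have h1 := infDist_le_infDist_add_dist (s := s) (x := x) (y := x + t • (y - x))
    have h2 : dist x (x + t • (y - x)) = t * infDist x s := by
      rw [hy, dist_self_add_right, norm_smul, Real.norm_of_nonneg ht.1, dist_comm, dist_eq_norm]
    linarith
  have hder := hd.hasFDerivAt.hasLineDerivAt (y - x)
  have hlim := hder.tendsto_slope_zero_right
  have hconst : Tendsto (fun t : ℝ => t⁻¹ • (infDist (x + t • (y - x)) s - infDist x s))
      (𝓝[>] 0) (𝓝 (-infDist x s)) := by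
    refine tendsto_const_nhds.congr' ?_
    filter_upwards [Ioc_mem_nhdsGT zero_lt_one] with t ht
    rw [hline t ⟨ht.1.le, ht.2⟩, smul_eq_mul]
    have := ht.1.ne'
    field_simp
    ring
  have heq := tendsto_nhds_unique hlim hconst
  have hle := (fderiv ℝ (fun z => infDist z s) x).le_opNorm (y - x)
  rw [heq, norm_neg, Real.norm_of_nonneg hx.le, ← dist_eq_norm, dist_comm, ← hy] at hle
  exact (le_mul_iff_one_le_left hx).1 hle

theorem lineDeriv_eq_zero_of_notMem_tsupport {f : E → ℝ} {x : E} (hx : x ∉ tsupport f) (v : E) :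
    lineDeriv ℝ f x v = 0 := by
  rw [(notMem_tsupport_iff_eventuallyEq.1 hx).lineDeriv_eq]
  simp [lineDeriv]

theorem ConcaveOn.lineDeriv_translate_sub_nonpos {Ω : Set E} {f : E → ℝ} (hΩo : IsOpen Ω)
    (hf : ConcaveOn ℝ Ω f) {x v : E} {t : ℝ} (ht : 0 < t) (hx : x ∈ Ω) (hxt : x + t • v ∈ Ω) :
    lineDeriv ℝ (fun z => f (z + t • v) - f z) x v ≤ 0 := by
  have hnhds : ∀ᶠ s : ℝ in 𝓝 0, x + s • v ∈ Ω ∧ x + s • v + t • v ∈ Ω := by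
    have hcont : Continuous fun s : ℝ => x + s • v := by fun_prop
    have hcont' : Continuous fun s : ℝ => x + s • v + t • v := by fun_prop
    exact (hcont.continuousAt.eventually_mem (by simpa using hΩo.mem_nhds hx)).and
      (hcont'.continuousAt.eventually_mem (by simpa using hΩo.mem_nhds hxt))
  obtain ⟨η, hη, hball⟩ := Metric.eventually_nhds_iff_ball.1 hnhds
  have hanti : AntitoneOn (fun s : ℝ => f (x + s • v + t • v) - f (x + s • v)) (ball 0 η) := by
    intro s hs s' hs' hss
    set d := s' - s with hd
    have hd0 : 0 ≤ d := sub_nonneg.2 hss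
    have hA := (hball s hs).1
    have hB := (hball s' hs').2
    have htd : 0 < t + d := by positivity
    have hsum : d / (t + d) + t / (t + d) = 1 := by field_simp; ring
    have hd' : 0 ≤ d / (t + d) := by positivity
    have ht' : 0 ≤ t / (t + d) := by positivity
    have h1 := hf.2 hA hB hd' ht' hsum
    have h2 := hf.2 hA hB ht' hd' (by rw [add_comm, hsum])
    have hs'eq : s' = s + d := by rw [hd]; ring
    have e1 : (d / (t + d)) • (x + s • v) + (t / (t + d)) • (x + s' • v + t • v)
        = x + s • v + t • v := by
      rw [hs'eq]
      match_scalars <;> field_simp <;> ring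
    have e2 : (t / (t + d)) • (x + s • v) + (d / (t + d)) • (x + s' • v + t • v)
        = x + s' • v := by
      rw [hs'eq]
      match_scalars <;> field_simp <;> ring
    rw [e1] at h1
    rw [e2] at h2
    simp only [smul_eq_mul] at h1 h2
    have h3 := congrArg (· * f (x + s • v)) hsum
    have h4 := congrArg (· * f (x + s' • v + t • v)) hsum
    linarith
  have h := hanti.derivWithin_nonpos (x := 0)
  rw [derivWithin_of_isOpen isOpen_ball (mem_ball_self hη)] at h
  exact h

variable [MeasurableSpace E] [BorelSpace E] [FiniteDimensional ℝ E]

theorem integrable_lineDeriv_of_hasCompactSupport {μ : Measure E} [μ.IsAddHaarMeasure]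
    {C : ℝ≥0} {Ψ : E → ℝ} (hΨ : LipschitzWith C Ψ) (hc : HasCompactSupport Ψ) (v : E) :
    Integrable (fun x => lineDeriv ℝ Ψ x v) μ := by
  have hsub : Function.support (fun x => lineDeriv ℝ Ψ x v) ⊆ tsupport Ψ := by
    intro x hx
    by_contra hxs
    refine hx ?_
    exact lineDeriv_eq_zero_of_notMem_tsupport hxs v
  rw [← integrableOn_iff_integrable_of_support_subset hsub]
  exact (hΨ.locallyIntegrable_lineDeriv v).integrableOn_isCompact hc

/-- A Lipschitz function that is concave on `Ω` has nonpositive second derivatives in every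
direction, in the sense of distributions on `Ω`. -/
theorem ConcaveOn.integral_lineDeriv_mul_lineDeriv_nonneg {μ : Measure E} [μ.IsAddHaarMeasure]
    {Ω : Set E} {f Ψ : E → ℝ} {C D : ℝ≥0} (hΩo : IsOpen Ω) (hf : ConcaveOn ℝ Ω f)
    (hfL : LipschitzWith D f) (hΨ : LipschitzWith C Ψ) (hc : HasCompactSupport Ψ)
    (hsub : tsupport Ψ ⊆ Ω) (h0 : ∀ x, 0 ≤ Ψ x) (v : E) :
    0 ≤ ∫ x, lineDeriv ℝ f x v * lineDeriv ℝ Ψ x v ∂μ := by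
  refine ge_of_tendsto (hfL.integral_inv_smul_sub_mul_tendsto_integral_lineDeriv_mul
    (integrable_lineDeriv_of_hasCompactSupport hΨ hc v) v) ?_
  obtain ⟨ε, hε, hthick⟩ := hc.isCompact.exists_cthickening_subset_open hΩo hsub
  have hsmall : ∀ᶠ t : ℝ in 𝓝[>] 0, ‖t • v‖ ≤ ε := by
    have hcont : Continuous fun t : ℝ => ‖t • v‖ := by fun_prop
    have := hcont.continuousAt (x := 0) |>.eventually_le_const (u := ε) (by simpa using hε)
    exact this.filter_mono nhdsWithin_le_nhds
  filter_upwards [hsmall, self_mem_nhdsWithin] with t ht (ht0 : 0 < t)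
  have hL : LipschitzWith (D + D) fun x => f (x + t • v) - f x := by
    refine LipschitzWith.sub ?_ hfL
    have h := hfL.comp (isometry_add_right (t • v)).lipschitz
    rwa [mul_one] at h
  have hparts := hL.integral_lineDeriv_mul_eq (μ := μ) hΨ hc v
  simp only [smul_eq_mul, mul_assoc, integral_const_mul]
  refine mul_nonneg (by positivity) ?_
  have hflip : ∫ x, (f (x + t • v) - f x) * lineDeriv ℝ Ψ x v ∂μ =
      -∫ x, lineDeriv ℝ (fun x => f (x + t • v) - f x) x v * Ψ x ∂μ := by
    rw [hparts, ← integral_neg]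
    congr 1
    ext x
    rw [lineDeriv_neg]
    ring
  rw [hflip, neg_nonneg]
  refine integral_nonpos fun x => ?_
  by_cases hx : x ∈ tsupport Ψ
  · refine mul_nonpos_of_nonpos_of_nonneg ?_ (h0 x)
    refine hf.lineDeriv_translate_sub_nonpos hΩo ht0 (hsub hx) (hthick ?_)
    refine mem_cthickening_of_dist_le _ x ε _ hx ?_
    simpa [dist_eq_norm] using ht
  · simp [image_eq_zero_of_notMem_tsupport hx]

end Geometry

section Assembly

open Metric
open scoped NNReal RealInnerProductSpace

theorem mul_rpow_sub_one_mul_le {p x y : ℝ} (hp : 1 ≤ p) (hx : 0 ≤ x) (hy : 0 ≤ y) :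
    p * x ^ (p - 1) * y ≤ (p - 1) * x ^ p + y ^ p := by
  rcases hx.eq_or_lt with rfl | hx
  · rcases hp.eq_or_lt with rfl | hp
    · simp
    · rw [Real.zero_rpow (by linarith), Real.zero_rpow (by linarith)]
      simpa using Real.rpow_nonneg hy p
  have hB := one_add_mul_self_le_rpow_one_add (s := y / x - 1)
    (by linarith [div_nonneg hy hx.le]) hp
  rw [add_sub_cancel, Real.div_rpow hy hx.le, le_div_iff₀ (by positivity)] at hB
  have e : x ^ (p - 1) = x ^ p / x := Real.rpow_sub_one hx.ne' p
  rw [e]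
  have : (1 + p * (y / x - 1)) * x ^ p = p * (x ^ p / x) * y - (p - 1) * x ^ p := by
    field_simp
    ring
  linarith

theorem LipschitzWith.exists_abs_rpow {E : Type*} [PseudoMetricSpace E] {g : E → ℝ} {C : ℝ≥0}
    {M p : ℝ} (hp : 1 ≤ p) (hg : LipschitzWith C g) (hM : ∀ x, |g x| ≤ M) :
    ∃ D : ℝ≥0, LipschitzWith D fun x => |g x| ^ p := by
  have key : ∀ x y, |g x| ^ p - |g y| ^ p ≤ p * |M| ^ (p - 1) * C * dist x y := by
    intro x y
    have hY := mul_rpow_sub_one_mul_le hp (abs_nonneg (g x)) (abs_nonneg (g y))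
    have hpow : |g x| ^ p = |g x| ^ (p - 1) * |g x| := by
      rcases (abs_nonneg (g x)).eq_or_lt with h | h
      · rw [← h, Real.zero_rpow (by linarith), mul_zero]
      · rw [Real.rpow_sub_one h.ne', div_mul_cancel₀ _ h.ne']
    have hle : |g x| ^ (p - 1) ≤ |M| ^ (p - 1) :=
      Real.rpow_le_rpow (abs_nonneg _) ((hM x).trans (le_abs_self M)) (by linarith)
    have hd : |g x| - |g y| ≤ C * dist x y :=
      (abs_sub_abs_le_abs_sub _ _).trans (by simpa [Real.dist_eq] using hg.dist_le_mul x y)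
    have hnn : 0 ≤ |g x| ^ (p - 1) := by positivity
    calc |g x| ^ p - |g y| ^ p ≤ p * (|g x| ^ (p - 1) * |g x|) - p * |g x| ^ (p - 1) * |g y| := by
          rw [← hpow]; linarith
      _ = p * |g x| ^ (p - 1) * (|g x| - |g y|) := by ring
      _ ≤ p * |g x| ^ (p - 1) * (C * dist x y) := by gcongr
      _ ≤ p * |M| ^ (p - 1) * (C * dist x y) := by gcongr
      _ = _ := by ring
  refine ⟨(p * |M| ^ (p - 1) * C).toNNReal, LipschitzWith.of_dist_le_mul fun x y => ?_⟩
  rw [Real.coe_toNNReal _ (by positivity), Real.dist_eq, abs_le]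
  have h1 := key x y
  have h2 := key y x
  rw [dist_comm y x] at h2
  exact ⟨by linarith, h1⟩

theorem abs_fderiv_abs_rpow_apply_le {E : Type*} [NormedAddCommGroup E] [NormedSpace ℝ E]
    {g : E → ℝ} {p : ℝ} {x : E} (hp : 1 ≤ p) (hg : DifferentiableAt ℝ g x) (v : E) :
    |fderiv ℝ (fun z => |g z| ^ p) x v| ≤ p * |g x| ^ (p - 1) * ‖fderiv ℝ g x‖ * ‖v‖ := by
  by_cases h0 : g x = 0
  · have hmin : IsLocalMin (fun z => |g z| ^ p) x := Eventually.of_forall fun z => by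
      simp only [h0, abs_zero]
      rw [Real.zero_rpow (by linarith)]
      positivity
    rw [hmin.fderiv_eq_zero]
    simp only [zero_apply, abs_zero]
    positivity
  · have hd : HasDerivAt (fun s : ℝ => |s| ^ p) (SignType.sign (g x) * p * |g x| ^ (p - 1)) (g x) :=
      (hasDerivAt_abs h0).rpow_const (Or.inl (by simpa using h0))
    have hcomp : HasFDerivAt (fun z => |g z| ^ p) _ x :=
      hd.comp_hasFDerivAt x hg.hasFDerivAt
    rw [hcomp.fderiv]
    have hsign : |((SignType.sign (g x) : SignType) : ℝ)| = 1 := by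
      rcases lt_or_gt_of_ne h0 with h | h <;> simp [h]
    have hle := (fderiv ℝ g x).le_opNorm v
    rw [smul_apply, smul_eq_mul, abs_mul, abs_mul, abs_mul, hsign, one_mul,
      abs_of_pos (by linarith : 0 < p), abs_of_nonneg (by positivity : 0 ≤ |g x| ^ (p - 1)),
      mul_assoc _ ‖fderiv ℝ g x‖]
    gcongr
    exact hle

theorem LipschitzWith.exists_mul_of_bounded {E : Type*} [PseudoMetricSpace E] {f k : E → ℝ}
    {C D : ℝ≥0} {A B : ℝ} (hf : LipschitzWith C f) (hk : LipschitzWith D k)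
    (hA : ∀ x, |f x| ≤ A) (hB : ∀ x, f x ≠ 0 → |k x| ≤ B) :
    ∃ K : ℝ≥0, LipschitzWith K fun x => f x * k x := by
  have key : ∀ x y, f y ≠ 0 → |f x * k x - f y * k y| ≤ (|A| * D + |B| * C) * dist x y := by
    intro x y hy
    have h1 : |k x - k y| ≤ D * dist x y := hk.dist_le_mul x y
    have h2 : |f x - f y| ≤ C * dist x y := hf.dist_le_mul x y
    calc |f x * k x - f y * k y| = |f x * (k x - k y) + k y * (f x - f y)| := by ring_nf
      _ ≤ |f x| * |k x - k y| + |k y| * |f x - f y| := by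
        rw [← abs_mul, ← abs_mul]
        exact abs_add_le _ _
      _ ≤ |A| * (D * dist x y) + |B| * (C * dist x y) := by
        have hA' := (hA x).trans (le_abs_self A)
        have hB' := (hB y hy).trans (le_abs_self B)
        exact add_le_add (mul_le_mul hA' h1 (abs_nonneg _) (abs_nonneg _))
          (mul_le_mul hB' h2 (abs_nonneg _) (abs_nonneg _))
      _ = _ := by ring
  refine ⟨(|A| * D + |B| * C).toNNReal, LipschitzWith.of_dist_le_mul fun x y => ?_⟩
  rw [Real.coe_toNNReal _ (by positivity), Real.dist_eq]
  by_cases hy : f y = 0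
  · by_cases hx : f x = 0
    · simp only [hx, hy, zero_mul, sub_zero, abs_zero]
      positivity
    · rw [abs_sub_comm, dist_comm]
      exact key y x hx
  · exact key x y hy

theorem LipschitzWith.exists_mul_comp {E : Type*} [PseudoMetricSpace E] {φ δ : E → ℝ} {h h' : ℝ → ℝ}
    {C D : ℝ≥0} (hφ : LipschitzWith C φ) (hc : HasCompactSupport φ) (hδ : LipschitzWith D δ)
    (hpos : ∀ x ∈ tsupport φ, 0 < δ x) (hh : ∀ t, 0 < t → HasDerivAt h (h' t) t)
    (hh' : ContinuousOn h' (Ioi 0)) : ∃ K : ℝ≥0, LipschitzWith K fun x => φ x * h (δ x) := by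
  obtain ⟨a, ha, hale⟩ := hc.isCompact.exists_forall_le' hδ.continuous.continuousOn hpos
  obtain ⟨b, hb⟩ := hc.isCompact.bddAbove_image hδ.continuous.continuousOn
  have hIcc : ∀ x ∈ tsupport φ, δ x ∈ Icc a b := fun x hx =>
    ⟨hale x hx, hb (mem_image_of_mem δ hx)⟩
  have hsub : Icc a b ⊆ Ioi 0 := fun t ht => ha.trans_le ht.1
  obtain ⟨M, hM⟩ := isCompact_Icc.exists_bound_of_continuousOn (hh'.mono hsub)
  have hhL : LipschitzOnWith M.toNNReal h (Icc a b) :=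
    (convex_Icc a b).lipschitzOnWith_of_nnnorm_hasDerivWithin_le
      (fun t ht => (hh t (hsub ht)).hasDerivWithinAt) fun t ht => by
        rw [← NNReal.coe_le_coe, coe_nnnorm]
        exact (hM t ht).trans (Real.le_coe_toNNReal M)
  obtain ⟨k, hk, hkeq⟩ := (hhL.comp hδ.lipschitzOnWith hIcc).extend_real
  obtain ⟨A, hA⟩ := hφ.continuous.bounded_above_of_compact_support hc
  obtain ⟨B, hB⟩ := hc.isCompact.exists_bound_of_continuousOn hk.continuous.continuousOn
  obtain ⟨K, hK⟩ := hφ.exists_mul_of_bounded hk hA fun x hx => hB x (subset_tsupport φ hx)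
  refine ⟨K, ?_⟩
  convert hK using 2 with x
  by_cases hx : x ∈ tsupport φ
  · rw [← hkeq hx, Function.comp_apply]
  · simp [image_eq_zero_of_notMem_tsupport hx]

theorem integrable_mul_comp_of_tsupport_subset {E : Type*} [TopologicalSpace E] [T2Space E]
    [MeasurableSpace E] [OpensMeasurableSpace E] {μ : Measure E} [IsFiniteMeasureOnCompacts μ]
    {f δ : E → ℝ} {q : ℝ → ℝ} (hf : Continuous f) (hc : HasCompactSupport f) (hδ : Continuous δ)
    (hpos : ∀ x ∈ tsupport f, 0 < δ x) (hq : ContinuousOn q (Ioi 0)) :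
    Integrable (fun x => f x * q (δ x)) μ := by
  have hsub : Function.support (fun x => f x * q (δ x)) ⊆ tsupport f :=
    (Function.support_mul_subset_left _ _).trans (subset_tsupport f)
  rw [← integrableOn_iff_integrable_of_support_subset hsub]
  exact (hf.continuousOn.mul (hq.comp hδ.continuousOn hpos)).integrableOn_compact' hc
    (isClosed_tsupport f).measurableSet

variable {n : ℕ}

/-- For a weight `h` that is nonnegative on the range of the distance `δ` to the boundary of a
convex set, `∫ |g|^p (-h'(δ)) ≤ p ∫ h(δ) |g|^(p-1) |∇g|`. -/
theorem integral_hardy_weight_nonneg {Ω : Set (EuclideanSpace ℝ (Fin n))}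
    (hΩo : IsOpen Ω) (hΩconv : Convex ℝ Ω) (hne : (frontier Ω).Nonempty) (hΩproper : Ω ≠ univ)
    {p : ℝ} (hp : 1 ≤ p) {h h' : ℝ → ℝ} (hh : ∀ t, 0 < t → HasDerivAt h (h' t) t)
    (hh' : ContinuousOn h' (Ioi 0)) (hh0 : ∀ x ∈ Ω, 0 ≤ h (infDist x (frontier Ω)))
    {g : EuclideanSpace ℝ (Fin n) → ℝ} (hg : ContDiff ℝ 1 g) (hsupp : HasCompactSupport g)
    (hsuppΩ : tsupport g ⊆ Ω) :
    Integrable (fun x => |g x| ^ p * h' (infDist x (frontier Ω))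
      + p * |g x| ^ (p - 1) * ‖fderiv ℝ g x‖ * h (infDist x (frontier Ω))) ∧
    0 ≤ ∫ x, (|g x| ^ p * h' (infDist x (frontier Ω))
      + p * |g x| ^ (p - 1) * ‖fderiv ℝ g x‖ * h (infDist x (frontier Ω))) := by
  set δ : EuclideanSpace ℝ (Fin n) → ℝ := fun x => infDist x (frontier Ω) with hδdef
  have hδL : LipschitzWith 1 δ := lipschitz_infDist_pt _
  have hδpos : ∀ x ∈ Ω, 0 < δ x := fun x hx => infDist_frontier_pos hΩo hne hx
  have hp0 : 0 < p := by linarith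
  set φ : EuclideanSpace ℝ (Fin n) → ℝ := fun x => |g x| ^ p with hφdef
  have hφsupp : tsupport φ ⊆ tsupport g := by
    refine closure_mono fun x hx => ?_
    contrapose! hx
    simp only [Function.notMem_support] at hx ⊢
    simp [hφdef, hx, hp0.ne']
  have hφc : HasCompactSupport φ := hsupp.mono' ((subset_tsupport φ).trans hφsupp)
  obtain ⟨M, hM⟩ := hg.continuous.bounded_above_of_compact_support hsupp
  obtain ⟨C, hC⟩ := ContDiff.lipschitzWith_of_hasCompactSupport hsupp hg one_ne_zero
  obtain ⟨D, hφL⟩ := hC.exists_abs_rpow hp hM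
  set Ψ : EuclideanSpace ℝ (Fin n) → ℝ := fun x => φ x * h (δ x) with hΨdef
  obtain ⟨K, hΨL⟩ : ∃ K : ℝ≥0, LipschitzWith K Ψ := hφL.exists_mul_comp hφc hδL
    (fun x hx => hδpos x (hsuppΩ (hφsupp hx))) hh hh'
  have hΨsupp : tsupport Ψ ⊆ tsupport g :=
    (closure_mono (Function.support_mul_subset_left _ _)).trans hφsupp
  have hΨc : HasCompactSupport Ψ := hsupp.mono' ((subset_tsupport Ψ).trans hΨsupp)
  have hΨ0 : ∀ x, 0 ≤ Ψ x := fun x => by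
    by_cases hx : x ∈ tsupport g
    · exact mul_nonneg (by positivity) (hh0 x (hsuppΩ hx))
    · simp [hΨdef, hφdef, image_eq_zero_of_notMem_tsupport hx, hp0.ne']
  set b := EuclideanSpace.basisFun (Fin n) ℝ with hb
  have hconc : ConcaveOn ℝ Ω δ := concaveOn_infDist_frontier hΩo hΩconv hne hΩproper
  have hlineInt : ∀ i, Integrable fun x => lineDeriv ℝ δ x (b i) * lineDeriv ℝ Ψ x (b i) := fun i =>
    (integrable_lineDeriv_of_hasCompactSupport hΨL hΨc (b i)).bdd_mul
      (aestronglyMeasurable_lineDeriv hδL.continuous _)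
      (Eventually.of_forall fun x => norm_lineDeriv_le_of_lipschitz ℝ hδL)
  have hS : 0 ≤ ∫ x, ∑ i, lineDeriv ℝ δ x (b i) * lineDeriv ℝ Ψ x (b i) := by
    rw [integral_finsetSum _ fun i _ => hlineInt i]
    exact Finset.sum_nonneg fun i _ => hconc.integral_lineDeriv_mul_lineDeriv_nonneg hΩo hδL hΨL
      hΨc (hΨsupp.trans hsuppΩ) hΨ0 (b i)
  have hφpos : ∀ x ∈ tsupport φ, 0 < δ x := fun x hx => hδpos x (hsuppΩ (hφsupp hx))
  have hDsupp : tsupport (fun x => p * |g x| ^ (p - 1) * ‖fderiv ℝ g x‖) ⊆ tsupport g := by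
    refine (closure_mono ?_).trans (tsupport_fderiv_subset ℝ (f := g))
    intro x hx
    contrapose! hx
    simp only [Function.notMem_support] at hx ⊢
    simp [hx]
  have hRint : Integrable fun x => φ x * h' (δ x)
      + p * |g x| ^ (p - 1) * ‖fderiv ℝ g x‖ * h (δ x) := by
    refine Integrable.add ?_ ?_
    · exact integrable_mul_comp_of_tsupport_subset hφL.continuous hφc hδL.continuous hφpos hh'
    · refine integrable_mul_comp_of_tsupport_subset ?_ ?_ hδL.continuous
        (fun x hx => hδpos x (hsuppΩ (hDsupp hx)))
        fun t ht => (hh t ht).continuousAt.continuousWithinAt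
      · have h1 : Continuous fun x => |g x| ^ (p - 1) :=
          hg.continuous.abs.rpow_const fun x => Or.inr (by linarith)
        have h2 := (hg.continuous_fderiv one_ne_zero).norm
        fun_prop
      · exact hsupp.mono' ((subset_tsupport _).trans hDsupp)
  refine ⟨hRint,
    hS.trans (integral_mono_ae (integrable_finsetSum _ fun i _ => hlineInt i) hRint ?_)⟩
  filter_upwards [hδL.ae_differentiableAt, hφL.ae_differentiableAt] with x hδx hφx
  by_cases hx : x ∈ tsupport g
  · have hxΩ := hsuppΩ hx
    have hnorm : ‖fderiv ℝ δ x‖ = 1 := norm_fderiv_infDist isClosed_frontier hne (hδpos x hxΩ) hδx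
    have hΨx : HasFDerivAt Ψ (φ x • (h' (δ x) • fderiv ℝ δ x) + h (δ x) • fderiv ℝ φ x) x :=
      hφx.hasFDerivAt.mul ((hh _ (hδpos x hxΩ)).comp_hasFDerivAt x hδx.hasFDerivAt)
    set v := (InnerProductSpace.toDual ℝ (EuclideanSpace ℝ (Fin n))).symm (fderiv ℝ δ x) with hv
    have hvapp : ∀ w, fderiv ℝ δ x w = ⟪v, w⟫ := fun w => by
      rw [hv, InnerProductSpace.toDual_symm_apply]
    have hvnorm : ‖v‖ = 1 := by rw [hv, LinearIsometryEquiv.norm_map, hnorm]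
    have hsum : ∑ i, lineDeriv ℝ δ x (b i) * lineDeriv ℝ Ψ x (b i) = fderiv ℝ Ψ x v := by
      conv_rhs => rw [← b.sum_repr' v, map_sum]
      refine Finset.sum_congr rfl fun i _ => ?_
      rw [hδx.lineDeriv_eq_fderiv, hΨx.differentiableAt.lineDeriv_eq_fderiv, hvapp, map_smul,
        smul_eq_mul, real_inner_comm]
    have hvv : fderiv ℝ δ x v = 1 := by
      rw [hvapp, real_inner_self_eq_norm_sq, hvnorm, one_pow]
    have hφv : fderiv ℝ φ x v ≤ p * |g x| ^ (p - 1) * ‖fderiv ℝ g x‖ := by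
      have := abs_fderiv_abs_rpow_apply_le hp ((hg.differentiable one_ne_zero) x) v
      rw [hvnorm, mul_one] at this
      exact (le_abs_self _).trans this
    rw [hsum, hΨx.fderiv]
    simp only [add_apply, smul_apply, smul_eq_mul, hvv,
      mul_one]
    rw [mul_comm (h (δ x))]
    have := mul_le_mul_of_nonneg_right hφv (hh0 x hxΩ)
    linarith
  · have hxΨ : x ∉ tsupport Ψ := fun hh => hx (hΨsupp hh)
    have hgx : g x = 0 := image_eq_zero_of_notMem_tsupport hx
    have hdx : fderiv ℝ g x = 0 :=
      image_eq_zero_of_notMem_tsupport fun hh => hx (tsupport_fderiv_subset ℝ hh)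
    simp [lineDeriv_eq_zero_of_notMem_tsupport hxΨ, hgx, hdx, hp0.ne']

end Assembly

theorem stmt_18 (n : ℕ) (Ω : Set (EuclideanSpace ℝ (Fin n)))
    (hΩo : IsOpen Ω) (hΩconv : Convex ℝ Ω) (hΩne : Ω.Nonempty) (hΩproper : Ω ≠ Set.univ)
    (δ₀ : ℝ) (hδ₀ : IsLUB ((fun x => Metric.infDist x (frontier Ω)) '' Ω) δ₀)
    (p m ν lam c jν : ℝ)
    (hp : 1 ≤ p) (hm : 1 < m) (hν : ν ∈ Set.Icc 0 (1 / m))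
    (hlam : lam ∈ Set.Ico 0 ((1 + ν * m) / 2))
    (hc : 0 < c)
    (hjν_pos : 0 < jν) (hjν_zero : besselJ ν jν = 0)
    (hjν_first : ∀ t ∈ Set.Ioo 0 jν, 0 < besselJ ν t)
    (hcm : 2 * c / m ∈ Set.Ioo 0 jν)
    (hroot : (1 - 2 * lam) * besselJ ν (2 * c / m)
      + 2 * c * deriv (besselJ ν) (2 * c / m) = 0)
    (g : EuclideanSpace ℝ (Fin n) → ℝ)
    (hg : ContDiff ℝ 1 g) (hsupp : HasCompactSupport g) (hsuppΩ : tsupport g ⊆ Ω) :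
    (1 - p * ν ^ 2 * m ^ 2) * (∫ x in Ω, |g x| ^ p / (Metric.infDist x (frontier Ω)) ^ 2)
      + 4 * p * (c ^ 2 + (m - 1) * (lam - lam ^ 2)) / δ₀ ^ m *
        (∫ x in Ω, |g x| ^ p / (Metric.infDist x (frontier Ω)) ^ ((2:ℝ) - m))
    ≤ p ^ p * (2 * (1 + ν * m) - 4 * lam ^ 2) ^ p *
        (∫ x in Ω, ‖fderiv ℝ g x‖ ^ p / (Metric.infDist x (frontier Ω)) ^ ((2:ℝ) - p)) := by
  have hm0 : 0 < m := by linarith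
  have hm1 : 0 < m - 1 := by linarith
  have hp0 : 0 < p := by linarith
  have hνm0 : 0 ≤ ν * m := mul_nonneg hν.1 hm0.le
  have hνm : ν * m ≤ 1 := (le_div_iff₀ hm0).1 hν.2
  have hne : (frontier Ω).Nonempty := nonempty_frontier_iff.2 ⟨hΩne, hΩproper⟩
  set δ : EuclideanSpace ℝ (Fin n) → ℝ := fun x => Metric.infDist x (frontier Ω) with hδdef
  have hδc : Continuous δ := Metric.continuous_infDist_pt _
  have hδpos : ∀ x ∈ Ω, 0 < δ x := fun x hx => infDist_frontier_pos hΩo hne hx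
  have hδle : ∀ x ∈ Ω, δ x ≤ δ₀ := fun x hx => hδ₀.1 (mem_image_of_mem δ hx)
  obtain ⟨x₀, hx₀⟩ := hΩne
  have hδ₀pos : 0 < δ₀ := (hδpos x₀ hx₀).trans_le (hδle x₀ hx₀)
  set A : ℝ := 1 - (ν * m) ^ 2 with hA
  set B : ℝ := 4 * (c ^ 2 + (m - 1) * (lam - lam ^ 2)) with hB
  set K : ℝ := 2 * (1 + ν * m) - 4 * lam ^ 2 with hK
  have hlam1 : lam ≤ 1 := by linarith [hlam.2]
  have hA0 : 0 ≤ A := by rw [hA]; nlinarith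
  have hB0 : 0 ≤ B := by
    have : 0 ≤ lam - lam ^ 2 := by nlinarith [hlam.1]
    positivity
  have hK0 : 0 ≤ K := by rw [hK]; nlinarith [hlam.1, hlam.2]
  set h : ℝ → ℝ := fun t => A * (t⁻¹ - δ₀⁻¹) + B / (m - 1) / δ₀ ^ m * (δ₀ ^ (m - 1) - t ^ (m - 1))
    with hh
  set h' : ℝ → ℝ := fun t => -(A / t ^ 2) - B / δ₀ ^ m * (t ^ ((2 : ℝ) - m))⁻¹ with hh'
  have hδ₀m : 0 < δ₀ ^ m := by positivity
  have hder : ∀ t, 0 < t → HasDerivAt h (h' t) t := by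
    intro t ht
    have h1 := ((hasDerivAt_inv ht.ne').sub_const δ₀⁻¹).const_mul A
    have h2 := ((Real.hasDerivAt_rpow_const (p := m - 1) (Or.inl ht.ne')).const_sub
      (δ₀ ^ (m - 1))).const_mul (B / (m - 1) / δ₀ ^ m)
    refine (h1.add h2).congr_deriv ?_
    have e : (t ^ ((2 : ℝ) - m))⁻¹ = t ^ (m - 1 - 1) := by
      rw [← Real.rpow_neg ht.le]
      congr 1
      ring
    simp only [hh', e]
    field_simp
    ring
  have hcont' : ContinuousOn h' (Ioi 0) := by
    intro t ht
    have ht0 : t ≠ 0 := (mem_Ioi.1 ht).ne'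
    have hpow : ContinuousAt (fun s : ℝ => s ^ ((2 : ℝ) - m)) t :=
      Real.continuousAt_rpow_const _ _ (Or.inl ht0)
    refine ContinuousAt.continuousWithinAt ?_
    exact ((continuousAt_const.div (continuousAt_id.pow 2) (pow_ne_zero 2 ht0)).neg).sub
      (continuousAt_const.mul (hpow.inv₀ (Real.rpow_pos_of_pos ht _).ne'))
  have hnonneg : ∀ x ∈ Ω, 0 ≤ h (δ x) := by
    intro x hx
    have h1 : δ₀⁻¹ ≤ (δ x)⁻¹ := inv_anti₀ (hδpos x hx) (hδle x hx)
    have h2 : δ x ^ (m - 1) ≤ δ₀ ^ (m - 1) :=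
      Real.rpow_le_rpow (hδpos x hx).le (hδle x hx) hm1.le
    have h3 := sub_nonneg.2 h1
    have h4 := sub_nonneg.2 h2
    simp only [hh]
    positivity
  have hweight : ∀ x ∈ Ω, h (δ x) ≤ K / δ x := by
    intro x hx
    have hx0 := hδpos x hx
    have ht : δ x / δ₀ ∈ Ioc (0 : ℝ) 1 := ⟨by positivity, (div_le_one hδ₀pos).2 (hδle x hx)⟩
    have key := hardy_weight_le hm hν hlam hc hjν_first hcm hroot ht
    rw [le_div_iff₀ hx0]
    refine le_trans (le_of_eq ?_) key
    simp only [hh]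
    rw [Real.div_rpow hx0.le hδ₀pos.le, Real.rpow_sub_one hδ₀pos.ne', Real.rpow_sub_one hx0.ne']
    field_simp
    rw [hA, hB]
    ring
  obtain ⟨hmainint, hmain⟩ := integral_hardy_weight_nonneg hΩo hΩconv hne hΩproper hp
    hder hcont' hnonneg hg hsupp hsuppΩ
  have hgp : Continuous fun x => |g x| ^ p := hg.continuous.abs.rpow_const fun x => Or.inr hp0.le
  have hdp : Continuous fun x => ‖fderiv ℝ g x‖ ^ p :=
    (hg.continuous_fderiv one_ne_zero).norm.rpow_const fun x => Or.inr hp0.le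
  have hgsupp : tsupport (fun x => |g x| ^ p) ⊆ tsupport g := by
    refine closure_mono fun x hx => ?_
    contrapose! hx
    simp only [Function.notMem_support] at hx ⊢
    simp [hx, hp0.ne']
  have hdsupp : tsupport (fun x => ‖fderiv ℝ g x‖ ^ p) ⊆ tsupport g := by
    refine (closure_mono fun x hx => ?_).trans (tsupport_fderiv_subset ℝ (f := g))
    contrapose! hx
    simp only [Function.notMem_support] at hx ⊢
    simp [hx, hp0.ne']
  have hpowinv : ∀ q : ℝ, ContinuousOn (fun t : ℝ => (t ^ q)⁻¹) (Ioi 0) := fun q t ht =>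
    ((Real.continuousAt_rpow_const _ _ (Or.inl (mem_Ioi.1 ht).ne')).inv₀
      (Real.rpow_pos_of_pos ht _).ne').continuousWithinAt
  have hI1 : Integrable fun x => |g x| ^ p / δ x ^ 2 := by
    simp only [div_eq_mul_inv]
    refine integrable_mul_comp_of_tsupport_subset (q := fun t => (t ^ 2)⁻¹) hgp
      (hsupp.mono' ((subset_tsupport _).trans hgsupp)) hδc
      (fun x hx => hδpos x (hsuppΩ (hgsupp hx))) fun t ht => ?_
    exact ((continuousAt_id.pow 2).inv₀ (pow_ne_zero 2 (mem_Ioi.1 ht).ne')).continuousWithinAt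
  have hI2 : Integrable fun x => |g x| ^ p / δ x ^ ((2 : ℝ) - m) := by
    simp only [div_eq_mul_inv]
    exact integrable_mul_comp_of_tsupport_subset (δ := δ) (q := fun t => (t ^ ((2 : ℝ) - m))⁻¹) hgp
      (hsupp.mono' ((subset_tsupport _).trans hgsupp)) hδc
      (fun x hx => hδpos x (hsuppΩ (hgsupp hx))) (hpowinv _)
  have hI3 : Integrable fun x => ‖fderiv ℝ g x‖ ^ p / δ x ^ ((2 : ℝ) - p) := by
    simp only [div_eq_mul_inv]
    exact integrable_mul_comp_of_tsupport_subset (δ := δ) (q := fun t => (t ^ ((2 : ℝ) - p))⁻¹) hdp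
      (hsupp.mono' ((subset_tsupport _).trans hdsupp)) hδc
      (fun x hx => hδpos x (hsuppΩ (hdsupp hx))) (hpowinv _)
  have hg0 : ∀ x ∉ Ω, g x = 0 := fun x hx =>
    image_eq_zero_of_notMem_tsupport fun hh => hx (hsuppΩ hh)
  have hd0 : ∀ x ∉ Ω, fderiv ℝ g x = 0 := fun x hx =>
    image_eq_zero_of_notMem_tsupport fun hh => hx (hsuppΩ (tsupport_fderiv_subset ℝ hh))
  rw [setIntegral_eq_integral_of_forall_compl_eq_zero fun x hx => by simp [hg0 x hx, hp0.ne'],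
    setIntegral_eq_integral_of_forall_compl_eq_zero fun x hx => by simp [hg0 x hx, hp0.ne'],
    setIntegral_eq_integral_of_forall_compl_eq_zero fun x hx => by simp [hd0 x hx, hp0.ne']]
  set F : EuclideanSpace ℝ (Fin n) → ℝ := fun x =>
    p ^ p * K ^ p * (‖fderiv ℝ g x‖ ^ p / δ x ^ ((2 : ℝ) - p))
      - ((1 - p * ν ^ 2 * m ^ 2) * (|g x| ^ p / δ x ^ 2)
        + p * B / δ₀ ^ m * (|g x| ^ p / δ x ^ ((2 : ℝ) - m))) with hF
  have hFint : Integrable F :=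
    (hI3.const_mul _).sub ((hI1.const_mul _).add (hI2.const_mul _))
  have hpt : ∀ x, p * (|g x| ^ p * h' (δ x) + p * |g x| ^ (p - 1) * ‖fderiv ℝ g x‖ * h (δ x))
      ≤ F x := by
    intro x
    by_cases hx : x ∈ Ω
    · have hx0 := hδpos x hx
      have hY := mul_rpow_sub_one_mul_le hp (abs_nonneg (g x))
        (by positivity : 0 ≤ p * K * ‖fderiv ℝ g x‖ * δ x)
      rw [Real.mul_rpow (by positivity) hx0.le, Real.mul_rpow (by positivity) (norm_nonneg _),
        Real.mul_rpow hp0.le hK0] at hY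
      have hW : p * |g x| ^ (p - 1) * ‖fderiv ℝ g x‖ * h (δ x) ≤
          p * |g x| ^ (p - 1) * ‖fderiv ℝ g x‖ * (K / δ x) := by
        gcongr
        exact hweight x hx
      have hY' := div_le_div_of_nonneg_right hY (sq_nonneg (δ x))
      have e3 : δ x ^ ((2 : ℝ) - p) = δ x ^ 2 / δ x ^ p := by
        rw [Real.rpow_sub hx0, Real.rpow_two]
      have eL : p * |g x| ^ (p - 1) * (p * K * ‖fderiv ℝ g x‖ * δ x) / δ x ^ 2 =
          p * (p * |g x| ^ (p - 1) * ‖fderiv ℝ g x‖ * (K / δ x)) := by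
        field_simp
      have eR : ((p - 1) * |g x| ^ p + p ^ p * K ^ p * ‖fderiv ℝ g x‖ ^ p * δ x ^ p) / δ x ^ 2 =
          (p - 1) * (|g x| ^ p / δ x ^ 2)
            + p ^ p * K ^ p * (‖fderiv ℝ g x‖ ^ p / δ x ^ ((2 : ℝ) - p)) := by
        rw [e3]
        field_simp
      rw [eL, eR] at hY'
      have hW' := mul_le_mul_of_nonneg_left hW hp0.le
      have eT : p * (|g x| ^ p * h' (δ x)) = -(p * A * (|g x| ^ p / δ x ^ 2))
          - p * B / δ₀ ^ m * (|g x| ^ p / δ x ^ ((2 : ℝ) - m)) := by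
        simp only [hh']
        ring
      have eA : p * A * (|g x| ^ p / δ x ^ 2) = (p - 1) * (|g x| ^ p / δ x ^ 2)
          + (1 - p * ν ^ 2 * m ^ 2) * (|g x| ^ p / δ x ^ 2) := by
        rw [hA]
        ring
      simp only [hF]
      rw [mul_add, eT, eA]
      linarith
    · simp [hF, hg0 x hx, hd0 x hx, hp0.ne']
  have hF0 : 0 ≤ ∫ x, F x := by
    have hnn := mul_nonneg hp0.le hmain
    rw [← integral_const_mul] at hnn
    exact hnn.trans (integral_mono (hmainint.const_mul p) hFint hpt)
  have hI12 : Integrable fun x => (1 - p * ν ^ 2 * m ^ 2) * (|g x| ^ p / δ x ^ 2)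
      + p * B / δ₀ ^ m * (|g x| ^ p / δ x ^ ((2 : ℝ) - m)) :=
    (hI1.const_mul _).add (hI2.const_mul _)
  simp only [hF] at hF0
  rw [integral_sub (hI3.const_mul _) hI12, integral_add (hI1.const_mul _) (hI2.const_mul _),
    integral_const_mul, integral_const_mul, integral_const_mul] at hF0
  have eB : 4 * p * (c ^ 2 + (m - 1) * (lam - lam ^ 2)) = p * B := by rw [hB]; ring
  rw [eB]
  linarith
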